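/- arXiv:2006.04704 — 6 statements merged into one kernel-verified Lean document; each statement's English description precedes it below -/
import Mathlib

section
/- Let f : Finset V → ℝ be a monotone submodular set function, let k ≥ 1 be a natural number and g > 0 a real number. Let E, O ⊆ V be finite sets with |O| ≤ k. If f(E ∪ {e}) - f(E) ≤ g/(2k) for every e ∈ O, then f(E) ≥ f(O) - g/2. -/
/-- If every element of an optimal set `O` (of size at most `k`)
has marginal gain at most `g/(2k)` with respect to `E`, then
`f E ≥ f O - g/2`, for `f` monotone and submodular. -/
theorem stmt_2 {V : Type*} [DecidableEq V] (f : Finset V → ℝ)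
    (hmono : ∀ X Y : Finset V, X ⊆ Y → f X ≤ f Y)
    (hsub : ∀ X Y : Finset V, X ⊆ Y → ∀ e ∉ Y,
      f (insert e Y) - f Y ≤ f (insert e X) - f X)
    (k : ℕ) (hk : 1 ≤ k) (g : ℝ) (hg : 0 < g)
    (E O : Finset V) (hO : O.card ≤ k)
    (hmarg : ∀ e ∈ O, f (insert e E) - f E ≤ g / (2 * k)) :
    f E ≥ f O - g / 2 := by
  have hk' : (0 : ℝ) < k := by exact_mod_cast hk
  have hc : 0 ≤ g / (2 * (k : ℝ)) := by positivity
  have key : ∀ S : Finset V, S ⊆ O → f (E ∪ S) ≤ f E + (S.card : ℝ) * (g / (2 * k)) := by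
    intro S
    induction S using Finset.induction_on with
    | empty => intro _; simp
    | insert a S ha ih =>
      intro hS
      have h1 := ih (fun x hx => hS (Finset.mem_insert_of_mem hx))
      have h2 := hmarg a (hS (Finset.mem_insert_self a S))
      rw [Finset.card_insert_of_notMem ha, Finset.union_insert]
      push_cast
      by_cases hm : a ∈ E ∪ S
      · rw [Finset.insert_eq_of_mem hm]
        linarith
      · have h3 := hsub E (E ∪ S) Finset.subset_union_left a hm
        linarith
  have h1 := key O (Finset.Subset.refl O)
  have h2 := hmono O (E ∪ O) Finset.subset_union_right
  have h3 : (O.card : ℝ) * (g / (2 * k)) ≤ k * (g / (2 * k)) :=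
    mul_le_mul_of_nonneg_right (by exact_mod_cast hO) hc
  have h4 : (k : ℝ) * (g / (2 * k)) = g / 2 := by
    field_simp
  linarith
end

section
/- Let V be a finite ground set, f : Finset V → ℝ a normalized monotone submodular set function, and k ≥ 1 a natural number. Let OPT = max { f(O) : O ⊆ V, |O| ≤ k }. Let E ⊆ V be such that f(E ∪ {e}) - f(E) ≤ OPT/(2k) for every e ∈ V. Then f(E) ≥ OPT/2. -/
/-- On a finite ground set, if every element has marginal gain at
most `OPT/(2k)` with respect to `E`, where `OPT` is the maximum value of `f` over
sets of cardinality at most `k`, then `f E ≥ OPT/2`. -/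
theorem stmt_3 {V : Type*} [Fintype V] [DecidableEq V] (f : Finset V → ℝ)
    (hnorm : f ∅ = 0)
    (hmono : ∀ X Y : Finset V, X ⊆ Y → f X ≤ f Y)
    (hsub : ∀ X Y : Finset V, X ⊆ Y → ∀ e ∉ Y,
      f (insert e Y) - f Y ≤ f (insert e X) - f X)
    (k : ℕ) (hk : 1 ≤ k) (OPT : ℝ)
    (hOPT : IsGreatest {x : ℝ | ∃ O : Finset V, O.card ≤ k ∧ f O = x} OPT)
    (E : Finset V)
    (hmarg : ∀ e : V, f (insert e E) - f E ≤ OPT / (2 * k)) :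
    f E ≥ OPT / 2 := by
  obtain ⟨⟨O, hO, hfO⟩, hub⟩ := hOPT
  have h0 : 0 ≤ OPT := hub ⟨∅, by simp, hnorm⟩
  have hk' : (0 : ℝ) < k := by exact_mod_cast hk
  have hc : 0 ≤ OPT / (2 * k) := by positivity
  have key : ∀ S : Finset V, f (E ∪ S) - f E ≤ S.card * (OPT / (2 * k)) := by
    intro S
    induction S using Finset.induction_on with
    | empty => simp
    | insert a S ha ih =>
      rw [Finset.card_insert_of_notMem ha, Finset.union_insert]
      push_cast
      by_cases h : a ∈ E ∪ S
      · rw [Finset.insert_eq_of_mem h]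
        linarith
      · have h1 := hsub E (E ∪ S) Finset.subset_union_left a h
        have h2 := hmarg a
        linarith
  have h1 := key O
  have h2 := hmono O (E ∪ O) Finset.subset_union_right
  have h3 : (O.card : ℝ) * (OPT / (2 * k)) ≤ k * (OPT / (2 * k)) :=
    mul_le_mul_of_nonneg_right (by exact_mod_cast hO) hc
  have h4 : (k : ℝ) * (OPT / (2 * k)) = OPT / 2 := by field_simp
  linarith
end

section
/- Let V be a finite ground set, f : Finset V → ℝ a normalized monotone submodular set function, and k ≥ 1 a natural number. Let OPT = max { f(O) : O ⊆ V, |O| ≤ k }. Let e_1, ..., e_m be distinct elements of V with m ≤ k such that for every ℓ with 1 ≤ ℓ ≤ m, f({e_1,...,e_ℓ}) - f({e_1,...,e_{ℓ-1}}) ≥ OPT/(2k). Set E = {e_1, ..., e_m}. If either m = k, or every e ∈ V satisfies f(E ∪ {e}) - f(E) ≤ OPT/(2k), then f(E) ≥ OPT/2. -/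
/-- Correctness of threshold-greedy peeling: if distinct elements
`e 0, ..., e (m-1)` are chosen so that each has marginal gain at least `OPT/(2k)`
with respect to the previously chosen ones, and either `m = k` or no element of the
ground set has marginal gain above `OPT/(2k)` with respect to `E = {e 0, ..., e (m-1)}`,
then `f E ≥ OPT/2`. -/
theorem stmt_4 {V : Type*} [Fintype V] [DecidableEq V] (f : Finset V → ℝ)
    (hnorm : f ∅ = 0)
    (hmono : ∀ X Y : Finset V, X ⊆ Y → f X ≤ f Y)
    (hsub : ∀ X Y : Finset V, X ⊆ Y → ∀ e ∉ Y,
      f (insert e Y) - f Y ≤ f (insert e X) - f X)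
    (k : ℕ) (hk : 1 ≤ k) (OPT : ℝ)
    (hOPT : IsGreatest {x : ℝ | ∃ O : Finset V, O.card ≤ k ∧ f O = x} OPT)
    (m : ℕ) (hm : m ≤ k) (e : ℕ → V)
    (hinj : ∀ i < m, ∀ j < m, e i = e j → i = j)
    (hstep : ∀ ℓ < m,
      f ((Finset.range (ℓ + 1)).image e) - f ((Finset.range ℓ).image e)
        ≥ OPT / (2 * k))
    (E : Finset V) (hE : E = (Finset.range m).image e)
    (hcase : m = k ∨ ∀ x : V, f (insert x E) - f E ≤ OPT / (2 * k)) :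
    f E ≥ OPT / 2 := by
  have hk0 : (0 : ℝ) < k := by exact_mod_cast hk
  have hkOPT : (k : ℝ) * (OPT / (2 * k)) = OPT / 2 := by
    field_simp
  have hOPT0 : 0 ≤ OPT := hOPT.2 ⟨∅, by simp, hnorm⟩
  have ht0 : 0 ≤ OPT / (2 * k) := by positivity
  rcases hcase with h | h
  · have key : ∀ l ≤ m, (l : ℝ) * (OPT / (2 * k)) ≤ f ((Finset.range l).image e) := by
      intro l
      induction l with
      | zero => intro _; simp [hnorm]
      | succ n ih =>
        intro hn
        have h1 := ih (by omega)
        have h2 := hstep n (by omega)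
        push_cast
        linarith
    have := key m le_rfl
    rw [← hE, h, hkOPT] at this
    exact this
  · obtain ⟨O, hO, hfO⟩ := hOPT.1
    have key : ∀ S : Finset V, f (E ∪ S) ≤ f E + (S.card : ℝ) * (OPT / (2 * k)) := by
      intro S
      induction S using Finset.induction_on with
      | empty => simp
      | insert a S ha ih =>
        rw [Finset.card_insert_of_notMem ha, Finset.union_insert]
        push_cast
        by_cases hmem : a ∈ E ∪ S
        · rw [Finset.insert_eq_of_mem hmem]
          linarith
        · have h1 := hsub E (E ∪ S) Finset.subset_union_left a hmem
          have h2 := h a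
          linarith
    have h1 := key O
    have h2 := hmono O (E ∪ O) Finset.subset_union_right
    have h3 : (O.card : ℝ) * (OPT / (2 * k)) ≤ k * (OPT / (2 * k)) :=
      mul_le_mul_of_nonneg_right (by exact_mod_cast hO) ht0
    linarith
end

section
/- Let f : Finset V → ℝ be a submodular set function, let τ > 0, ε ∈ [0, 1], ε_1 ≥ 0 and ε_p ∈ [0, 1) be reals, and let P, S ⊆ V be disjoint finite sets. Suppose that f(P ∪ {e}) - f(P) ≤ (1 + ε_1)·τ for every e ∈ S, that f(P ∪ S) - f(P) ≥ (1 - ε_p)·τ·|S|, and that D ⊆ S satisfies |D| ≤ ε·|S|. Then f(P ∪ (S \ D)) - f(P) ≥ (1 - ε·(1 + ε_1)/(1 - ε_p)) · (f(P ∪ S) - f(P)). -/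
/-- Quantitative deletion-robustness of a bucket: if every element
of `S` has marginal gain at most `(1+ε₁)τ` with respect to `P`, the total marginal
contribution of `S` is at least `(1-ε_p)·τ·|S|`, and at most an `ε`-fraction `D` of
`S` is deleted, then the remaining contribution is at least a
`(1 - ε(1+ε₁)/(1-ε_p))`-fraction of the original. -/
theorem stmt_13 {V : Type*} [DecidableEq V] (f : Finset V → ℝ)
    (hsub : ∀ X Y : Finset V, X ⊆ Y → ∀ e ∉ Y,
      f (insert e Y) - f Y ≤ f (insert e X) - f X)
    (τ ε ε₁ εp : ℝ) (hτ : 0 < τ) (hε0 : 0 ≤ ε) (hε1 : ε ≤ 1)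
    (hε₁ : 0 ≤ ε₁) (hεp0 : 0 ≤ εp) (hεp1 : εp < 1)
    (P S : Finset V) (hPS : Disjoint P S)
    (hup : ∀ e ∈ S, f (insert e P) - f P ≤ (1 + ε₁) * τ)
    (hlow : f (P ∪ S) - f P ≥ (1 - εp) * τ * S.card)
    (D : Finset V) (hDS : D ⊆ S) (hDcard : (D.card : ℝ) ≤ ε * S.card) :
    f (P ∪ (S \ D)) - f P
      ≥ (1 - ε * (1 + ε₁) / (1 - εp)) * (f (P ∪ S) - f P) := by
  have key : ∀ D : Finset V, D ⊆ S →
      f (P ∪ S) ≤ f (P ∪ (S \ D)) + D.card * ((1 + ε₁) * τ) := by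
    intro D
    induction D using Finset.induction_on with
    | empty => intro _; simp
    | insert a D ha ih =>
      intro h
      have haS : a ∈ S := h (Finset.mem_insert_self a D)
      have haP : a ∉ P := fun hp => Finset.disjoint_left.mp hPS hp haS
      have h1 := ih (fun x hx => h (Finset.mem_insert_of_mem hx))
      have heq : P ∪ (S \ D) = insert a (P ∪ (S \ insert a D)) := by
        ext x
        simp only [Finset.mem_union, Finset.mem_sdiff, Finset.mem_insert]
        by_cases hx : x = a
        · subst hx; simp [haS, ha]
        · simp [hx]
      have h2 := hsub P (P ∪ (S \ insert a D)) Finset.subset_union_left a (by simp [haP])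
      rw [← heq] at h2
      have h3 := hup a haS
      rw [Finset.card_insert_of_notMem ha]
      push_cast
      linarith
  have h1 := key D hDS
  have hc : 0 ≤ (1 + ε₁) * τ := by positivity
  have h2 := mul_le_mul_of_nonneg_right hDcard hc
  have hp : 0 < 1 - εp := by linarith
  have hk : 0 ≤ ε * (1 + ε₁) / (1 - εp) := by positivity
  have h3 := mul_le_mul_of_nonneg_left hlow hk
  have h4 : ε * (1 + ε₁) / (1 - εp) * ((1 - εp) * τ * S.card)
      = ε * S.card * ((1 + ε₁) * τ) := by
    field_simp
  rw [h4] at h3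
  linarith
end

section
/- Let N be a finite set and f : Finset N → ℝ a monotone submodular set function. For 0 ≤ t < |N| define g(t) = (C(|N|, t) · (|N| - t))^{-1} · Σ_{T ⊆ N, |T| = t} Σ_{x ∈ N \ T} (f(T ∪ {x}) - f(T)), the expected marginal gain of a uniformly random element x with respect to a uniformly random size-t subset T. Then g is nonincreasing: for all s with 0 ≤ s and s + 1 < |N|, g(s + 1) ≤ g(s). -/
theorem aux_double {N : Type*} [Fintype N] [DecidableEq N] (h : Finset N → ℝ) (s : ℕ) :
    ∑ T ∈ Finset.powersetCard s (Finset.univ : Finset N), ∑ y ∈ Finset.univ \ T, h (insert y T)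
      = (s + 1 : ℝ) * ∑ U ∈ Finset.powersetCard (s + 1) (Finset.univ : Finset N), h U := by
  have h1 : (s + 1 : ℝ) * ∑ U ∈ Finset.powersetCard (s + 1) (Finset.univ : Finset N), h U
      = ∑ U ∈ Finset.powersetCard (s + 1) (Finset.univ : Finset N), ∑ _y ∈ U, h U := by
    rw [Finset.mul_sum]
    refine Finset.sum_congr rfl fun U hU => ?_
    rw [Finset.sum_const, (Finset.mem_powersetCard.1 hU).2, nsmul_eq_mul]
    push_cast
    ring
  rw [h1, Finset.sum_sigma', Finset.sum_sigma']
  refine Finset.sum_bij' (fun p _ => ⟨insert p.2 p.1, p.2⟩) (fun p _ => ⟨p.1.erase p.2, p.2⟩)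
    ?_ ?_ ?_ ?_ ?_
  · rintro ⟨T, y⟩ hp
    simp only [Finset.mem_sigma, Finset.mem_powersetCard, Finset.mem_sdiff] at hp ⊢
    exact ⟨⟨Finset.subset_univ _, by rw [Finset.card_insert_of_notMem hp.2.2, hp.1.2]⟩,
      Finset.mem_insert_self _ _⟩
  · rintro ⟨T, y⟩ hp
    simp only [Finset.mem_sigma, Finset.mem_powersetCard, Finset.mem_sdiff] at hp ⊢
    exact ⟨⟨Finset.subset_univ _, by rw [Finset.card_erase_of_mem hp.2, hp.1.2]; rfl⟩,
      Finset.mem_univ _, Finset.notMem_erase _ _⟩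
  · rintro ⟨T, y⟩ hp
    simp only [Finset.mem_sigma, Finset.mem_sdiff] at hp
    simp [Finset.erase_insert hp.2.2]
  · rintro ⟨T, y⟩ hp
    simp only [Finset.mem_sigma] at hp
    simp [Finset.insert_erase hp.2]
  · rintro ⟨T, y⟩ hp
    rfl

/-- For a monotone submodular function on a finite ground set `N`,
the expected marginal gain `g t` of a uniformly random element with respect to a
uniformly random size-`t` subset is nonincreasing in `t`. -/
theorem stmt_14 {N : Type*} [Fintype N] [DecidableEq N] (f : Finset N → ℝ)
    (hmono : ∀ X Y : Finset N, X ⊆ Y → f X ≤ f Y)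
    (hsub : ∀ X Y : Finset N, X ⊆ Y → ∀ e ∉ Y,
      f (insert e Y) - f Y ≤ f (insert e X) - f X)
    (g : ℕ → ℝ)
    (hg : ∀ t < Fintype.card N, g t =
      ((((Fintype.card N).choose t * (Fintype.card N - t) : ℕ) : ℝ))⁻¹ *
        ∑ T ∈ Finset.powersetCard t (Finset.univ : Finset N),
          ∑ x ∈ Finset.univ \ T, (f (insert x T) - f T))
    (s : ℕ) (hs : s + 1 < Fintype.card N) :
    g (s + 1) ≤ g s := by
  have key := aux_double (fun U => ∑ x ∈ Finset.univ \ U, (f (insert x U) - f U)) s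
  have hle : ∑ T ∈ Finset.powersetCard s (Finset.univ : Finset N), ∑ y ∈ Finset.univ \ T,
      ∑ x ∈ Finset.univ \ (insert y T), (f (insert x (insert y T)) - f (insert y T))
      ≤ ((Fintype.card N : ℝ) - s - 1) * ∑ T ∈ Finset.powersetCard s (Finset.univ : Finset N),
          ∑ x ∈ Finset.univ \ T, (f (insert x T) - f T) := by
    rw [Finset.mul_sum]
    refine Finset.sum_le_sum fun T hT => ?_
    have hc := (Finset.mem_powersetCard.1 hT).2
    have hcard : ((Finset.univ \ T).card : ℝ) = (Fintype.card N : ℝ) - s := by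
      rw [Finset.card_sdiff_of_subset (Finset.subset_univ _), hc, Finset.card_univ,
        Nat.cast_sub (by omega)]
    calc _ ≤ ∑ y ∈ Finset.univ \ T, (∑ x ∈ Finset.univ \ T, (f (insert x T) - f T)
              - (f (insert y T) - f T)) := by
          refine Finset.sum_le_sum fun y hy => ?_
          rw [← Finset.sum_erase_eq_sub hy, ← Finset.erase_sdiff_comm, ]
          have he : Finset.univ \ insert y T = (Finset.univ.erase y) \ T := by
            ext z; simp
          rw [he]
          refine Finset.sum_le_sum fun x hx => ?_
          refine hsub T (insert y T) (Finset.subset_insert _ _) x ?_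
          simpa using hx
      _ = _ := by
          rw [Finset.sum_sub_distrib, Finset.sum_const, nsmul_eq_mul, hcard]
          ring
  rw [key] at hle
  rw [hg s (by omega), hg (s + 1) hs]
  have hch := Nat.choose_succ_right_eq (Fintype.card N) s
  have hpos : 0 < (Fintype.card N).choose s := Nat.choose_pos (by omega)
  have hpos' : 0 < (Fintype.card N).choose (s + 1) := Nat.choose_pos (by omega)
  generalize ∑ T ∈ Finset.powersetCard s (Finset.univ : Finset N),
          ∑ x ∈ Finset.univ \ T, (f (insert x T) - f T) = A at *
  generalize ∑ T ∈ Finset.powersetCard (s + 1) (Finset.univ : Finset N),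
          ∑ x ∈ Finset.univ \ T, (f (insert x T) - f T) = B at *
  generalize (Fintype.card N).choose s = c at *
  generalize (Fintype.card N).choose (s + 1) = d at *
  obtain ⟨m, hm⟩ : ∃ m, Fintype.card N = s + 1 + (m + 1) := ⟨Fintype.card N - s - 2, by omega⟩
  rw [hm] at hle hch ⊢
  rw [show s + 1 + (m + 1) - s = m + 2 by omega] at hch ⊢
  rw [show s + 1 + (m + 1) - (s + 1) = m + 1 by omega]
  have hch' : (d : ℝ) * (s + 1) = c * (m + 2) := by exact_mod_cast hch
  have hc0 : (0 : ℝ) < c := by exact_mod_cast hpos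
  have hd0 : (0 : ℝ) < d := by exact_mod_cast hpos'
  push_cast at hle ⊢
  rw [← hch', inv_mul_eq_div, inv_mul_eq_div, div_le_div_iff₀ (by positivity) (by positivity)]
  nlinarith [mul_le_mul_of_nonneg_left hle hd0.le]
end

section
/- Let N be a finite set and f : Finset N → ℝ a normalized set function (f(∅) = 0). For 0 ≤ t < |N| define g(t) = (C(|N|, t) · (|N| - t))^{-1} · Σ_{T ⊆ N, |T| = t} Σ_{x ∈ N \ T} (f(T ∪ {x}) - f(T)). Then for every s with 1 ≤ s ≤ |N|, the average value of f over all size-s subsets of N satisfies C(|N|, s)^{-1} · Σ_{S ⊆ N, |S| = s} f(S) = Σ_{t=0}^{s-1} g(t). -/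
theorem aux_count {N : Type*} [Fintype N] [DecidableEq N] (f : Finset N → ℝ) (t : ℕ) :
    ∑ T ∈ Finset.powersetCard t (Finset.univ : Finset N),
      ∑ x ∈ Finset.univ \ T, f (insert x T)
    = ((t : ℝ) + 1) * ∑ S ∈ Finset.powersetCard (t + 1) (Finset.univ : Finset N), f S := by
  have h : ((t : ℝ) + 1) * ∑ S ∈ Finset.powersetCard (t + 1) (Finset.univ : Finset N), f S
      = ∑ S ∈ Finset.powersetCard (t + 1) (Finset.univ : Finset N), ∑ _x ∈ S, f S := by
    rw [Finset.mul_sum]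
    refine Finset.sum_congr rfl fun S hS => ?_
    rw [Finset.sum_const, (Finset.mem_powersetCard.mp hS).2, nsmul_eq_mul]
    push_cast
    rfl
  rw [h, Finset.sum_sigma', Finset.sum_sigma']
  refine Finset.sum_bij' (fun p _ => ⟨insert p.2 p.1, p.2⟩) (fun p _ => ⟨p.1.erase p.2, p.2⟩)
    ?_ ?_ ?_ ?_ ?_
  · rintro ⟨T, x⟩ h
    simp only [Finset.mem_sigma, Finset.mem_powersetCard_univ, Finset.mem_sdiff,
      Finset.mem_univ, true_and] at h ⊢
    simp [Finset.card_insert_of_notMem h.2, h.1]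
  · rintro ⟨T, x⟩ h
    simp only [Finset.mem_sigma, Finset.mem_powersetCard_univ, Finset.mem_sdiff,
      Finset.mem_univ, true_and] at h ⊢
    simp [Finset.card_erase_of_mem h.2, h.1]
  · rintro ⟨T, x⟩ h
    simp only [Finset.mem_sigma, Finset.mem_powersetCard_univ, Finset.mem_sdiff,
      Finset.mem_univ, true_and] at h
    simp [Finset.erase_insert h.2]
  · rintro ⟨T, x⟩ h
    simp only [Finset.mem_sigma] at h
    simp [Finset.insert_erase h.2]
  · rintro ⟨T, x⟩ h
    rfl

/-- For a normalized set function on a finite ground set `N`, the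
average value of `f` over all size-`s` subsets equals the sum `Σ_{t=0}^{s-1} g t` of
the expected marginal gains of successively added random elements. -/
theorem stmt_16 {N : Type*} [Fintype N] [DecidableEq N] (f : Finset N → ℝ)
    (hnorm : f ∅ = 0)
    (g : ℕ → ℝ)
    (hg : ∀ t < Fintype.card N, g t =
      ((((Fintype.card N).choose t * (Fintype.card N - t) : ℕ) : ℝ))⁻¹ *
        ∑ T ∈ Finset.powersetCard t (Finset.univ : Finset N),
          ∑ x ∈ Finset.univ \ T, (f (insert x T) - f T))
    (s : ℕ) (hs1 : 1 ≤ s) (hs2 : s ≤ Fintype.card N) :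
    (((Fintype.card N).choose s : ℝ))⁻¹ *
        ∑ S ∈ Finset.powersetCard s (Finset.univ : Finset N), f S
      = ∑ t ∈ Finset.range s, g t := by
  clear hs1
  induction s with
  | zero => simp [hnorm]
  | succ t ih =>
    have ht : t < Fintype.card N := hs2
    rw [Finset.sum_range_succ, ← ih ht.le, hg t ht]
    simp only [Finset.sum_sub_distrib]
    rw [aux_count]
    have hc : ∑ T ∈ Finset.powersetCard t (Finset.univ : Finset N),
        ∑ _x ∈ Finset.univ \ T, f T
        = ((Fintype.card N - t : ℕ) : ℝ) *
          ∑ T ∈ Finset.powersetCard t (Finset.univ : Finset N), f T := by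
      rw [Finset.mul_sum]
      refine Finset.sum_congr rfl fun T hT => ?_
      rw [Finset.sum_const, nsmul_eq_mul, ← Finset.compl_eq_univ_sdiff, Finset.card_compl,
        (Finset.mem_powersetCard.mp hT).2]
    rw [hc]
    have hk : (((Fintype.card N).choose (t + 1) : ℝ)) * ((t : ℝ) + 1)
        = ((Fintype.card N).choose t : ℝ) * ((Fintype.card N - t : ℕ) : ℝ) := by
      exact_mod_cast Nat.choose_succ_right_eq (Fintype.card N) t
    have h1 : ((Fintype.card N).choose (t + 1) : ℝ) ≠ 0 := by
      exact_mod_cast (Nat.choose_pos hs2).ne'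
    have h2 : ((Fintype.card N).choose t : ℝ) ≠ 0 := by
      exact_mod_cast (Nat.choose_pos ht.le).ne'
    have h3 : ((Fintype.card N - t : ℕ) : ℝ) ≠ 0 := by
      exact_mod_cast (Nat.sub_pos_of_lt ht).ne'
    have h4 : (t : ℝ) + 1 ≠ 0 := by positivity
    rw [Nat.cast_mul, mul_sub]
    nth_rewrite 1 [← hk]
    generalize ((Fintype.card N - t : ℕ) : ℝ) = m at *
    field_simp
    ring
end
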